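/- arXiv:1307.0399 — 4 statements merged into one kernel-verified Lean document; each statement's English description precedes it below -/
import Mathlib

section
/- Let n ≥ 2, let h : ℝⁿ₊ → ℝ₊ be a twice continuously differentiable function that is homogeneous of degree d with d ≠ 0 and d ≠ 1, and suppose h satisfies the homogeneous Monge–Ampère equation det(h_ij) = 0 at every point of ℝⁿ₊. Then for every twice continuously differentiable function F : ℝ₊ → ℝ with F′ ≠ 0 everywhere, the homothetic function f = F ∘ h satisfies the homogeneous Monge–Ampère equation det(f_ij) = 0 at every point of ℝⁿ₊. -/
open Real

/-- Partial derivative of `f` in the `i`-th coordinate direction. -/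
noncomputable def pd {n : ℕ} (i : Fin n) (f : (Fin n → ℝ) → ℝ) (x : Fin n → ℝ) : ℝ :=
  fderiv ℝ f x (Pi.single i 1)

/-- Hessian matrix of second partial derivatives of `f` at `x`. -/
noncomputable def hess {n : ℕ} (f : (Fin n → ℝ) → ℝ) (x : Fin n → ℝ) :
    Matrix (Fin n) (Fin n) ℝ :=
  fun i j => pd i (pd j f) x

/-- Hessian determinant `det(f_ij)` of `f` at `x`. -/
noncomputable def hessDet {n : ℕ} (f : (Fin n → ℝ) → ℝ) (x : Fin n → ℝ) : ℝ :=
  (hess f x).det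

/-- The open positive orthant `ℝⁿ₊`. -/
def posOrth (n : ℕ) : Set (Fin n → ℝ) := {x | ∀ i, 0 < x i}

theorem posOrth_open (n : ℕ) : IsOpen (posOrth n) := by
  have : posOrth n = ⋂ i, {x : Fin n → ℝ | 0 < x i} := by
    ext x; simp [posOrth]
  rw [this]
  exact isOpen_iInter_of_finite fun i => isOpen_lt continuous_const (continuous_apply i)

theorem euler_aux {n : ℕ} (d : ℝ) (h : (Fin n → ℝ) → ℝ) (x : Fin n → ℝ)
    (hx : DifferentiableAt ℝ h x)
    (hhom : ∀ t : ℝ, 0 < t → h (t • x) = t ^ d * h x) :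
    ∑ j, x j * pd j h x = d * h x := by
  have h1 : HasDerivAt (fun t : ℝ => t • x) x 1 := by
    simpa using (hasDerivAt_id (1 : ℝ)).smul_const x
  have hx' : HasFDerivAt h (fderiv ℝ h x) ((1 : ℝ) • x) := by
    rw [one_smul]; exact hx.hasFDerivAt
  have h2 : HasDerivAt (fun t : ℝ => h (t • x)) (fderiv ℝ h x x) 1 :=
    hx'.comp_hasDerivAt (1 : ℝ) h1
  have h3 : HasDerivAt (fun t : ℝ => t ^ d * h x) (d * h x) 1 := by
    have := (Real.hasDerivAt_rpow_const (x := 1) (p := d) (Or.inl one_ne_zero)).mul_const (h x)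
    simpa using this
  have h4 : (fun t : ℝ => h (t • x)) =ᶠ[nhds 1] fun t : ℝ => t ^ d * h x := by
    filter_upwards [lt_mem_nhds (zero_lt_one : (0 : ℝ) < 1)] with t ht using hhom t ht
  have h5 : fderiv ℝ h x x = d * h x := h2.unique (h3.congr_of_eventuallyEq h4)
  rw [← h5]
  generalize hL : fderiv ℝ h x = L
  conv_rhs => rw [pi_eq_sum_univ' x]
  simp [map_sum, pd, hL]

theorem diff_pd {n : ℕ} (h : (Fin n → ℝ) → ℝ) (x : Fin n → ℝ)
    (hx : ContDiffAt ℝ 2 h x) (j : Fin n) : DifferentiableAt ℝ (pd j h) x := by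
  have h1 : ContDiffAt ℝ 1 (fderiv ℝ h) x := hx.fderiv_right (by norm_num)
  exact (h1.differentiableAt (by norm_num)).clm_apply (differentiableAt_const _)

/-- If `h : ℝⁿ₊ → ℝ₊` is C², homogeneous of degree `d` (`d ≠ 0`, `d ≠ 1`),
and satisfies `det(h_ij) = 0` on `ℝⁿ₊`, then for every C² function `F : ℝ₊ → ℝ` with
`F′ ≠ 0` everywhere, `f = F ∘ h` satisfies `det(f_ij) = 0` on `ℝⁿ₊`. -/
theorem stmt_0 {n : ℕ} (hn : 2 ≤ n) (d : ℝ) (hd0 : d ≠ 0) (hd1 : d ≠ 1)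
    (h : (Fin n → ℝ) → ℝ)
    (hC2 : ContDiffOn ℝ 2 h (posOrth n))
    (hpos : ∀ x ∈ posOrth n, 0 < h x)
    (hhom : ∀ t : ℝ, 0 < t → ∀ x ∈ posOrth n, h (t • x) = t ^ d * h x)
    (hMA : ∀ x ∈ posOrth n, hessDet h x = 0)
    (F : ℝ → ℝ) (hFC2 : ContDiffOn ℝ 2 F (Set.Ioi (0 : ℝ)))
    (hF' : ∀ u : ℝ, 0 < u → deriv F u ≠ 0) :
    ∀ x ∈ posOrth n, hessDet (fun y => F (h y)) x = 0 := by
  intro x hx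
  have hn0 := posOrth_open n
  have hC : ∀ y ∈ posOrth n, ContDiffAt ℝ 2 h y := fun y hy => hC2.contDiffAt (hn0.mem_nhds hy)
  have hD : ∀ y ∈ posOrth n, DifferentiableAt ℝ h y := fun y hy =>
    (hC y hy).differentiableAt (by norm_num)
  have hFC : ∀ u : ℝ, 0 < u → ContDiffAt ℝ 2 F u := fun u hu =>
    hFC2.contDiffAt (Ioi_mem_nhds hu)
  have hFD : ∀ u : ℝ, 0 < u → DifferentiableAt ℝ F u := fun u hu =>
    (hFC u hu).differentiableAt (by norm_num)
  have hF2 : ∀ u : ℝ, 0 < u → DifferentiableAt ℝ (deriv F) u := fun u hu => by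
    have h1 : ContDiffAt ℝ 1 (fderiv ℝ F) u := (hFC u hu).fderiv_right (by norm_num)
    exact (h1.differentiableAt (by norm_num)).clm_apply (differentiableAt_const _)
  have hpd : ∀ j, DifferentiableAt ℝ (pd j h) x := diff_pd h x (hC x hx)
  -- H x = (d-1) g
  have hE : ∀ i, ∑ j, hess h x i j * x j = (d - 1) * pd i h x := by
    intro i
    have e1 : (fun y : Fin n → ℝ => ∑ j, y j * pd j h y) =ᶠ[nhds x] fun y => d * h y := by
      filter_upwards [hn0.mem_nhds hx] with y hy
      exact euler_aux d h y (hD y hy) fun t ht => hhom t ht y hy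
    have e2 : HasFDerivAt (fun y : Fin n → ℝ => ∑ j, y j * pd j h y)
        (∑ j, (x j • fderiv ℝ (pd j h) x + pd j h x • ContinuousLinearMap.proj (R := ℝ) (φ := fun _ : Fin n => ℝ) j)) x := by
      refine HasFDerivAt.fun_sum fun j _ => ?_
      exact (hasFDerivAt_apply (𝕜 := ℝ) (F' := fun _ : Fin n => ℝ) j x).mul (hpd j).hasFDerivAt
    have e3 : HasFDerivAt (fun y => d * h y) (d • fderiv ℝ h x) x :=
      (hD x hx).hasFDerivAt.const_mul d
    have e4 := e2.unique (e3.congr_of_eventuallyEq e1)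
    have e5 := congrArg (fun L => L (Pi.single i 1)) e4
    simp [Finset.sum_add_distrib, Pi.single_apply] at e5
    have e6 : ∑ j, hess h x i j * x j = ∑ j, x j * (fderiv ℝ (pd j h) x) (Pi.single i 1) :=
      Finset.sum_congr rfl fun j _ => mul_comm _ _
    rw [e6]
    have e7 : (fderiv ℝ h x) (Pi.single i 1) = pd i h x := rfl
    rw [e7] at e5
    linarith
  have hf : ∀ i j, hess (fun y => F (h y)) x i j
      = deriv (deriv F) (h x) * pd i h x * pd j h x + deriv F (h x) * hess h x i j := by
    intro i j
    have e1 : pd j (fun y => F (h y)) =ᶠ[nhds x] fun y => deriv F (h y) * pd j h y := by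
      filter_upwards [hn0.mem_nhds hx] with y hy
      have := (hFD _ (hpos y hy)).hasDerivAt.comp_hasFDerivAt y (hD y hy).hasFDerivAt
      have h2 : fderiv ℝ (fun y => F (h y)) y = deriv F (h y) • fderiv ℝ h y := this.fderiv
      simp [pd, h2]
    have e2 := ((hF2 _ (hpos x hx)).hasDerivAt.comp_hasFDerivAt x (hD x hx).hasFDerivAt).mul
      (hpd j).hasFDerivAt
    have e3 := (e2.congr_of_eventuallyEq e1).fderiv
    show fderiv ℝ (pd j (fun y => F (h y))) x (Pi.single i 1) = _
    rw [e3]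
    simp [hess, pd]
    ring
  obtain ⟨v, hv0, hv⟩ := Matrix.exists_vecMul_eq_zero_iff.mpr (hMA x hx)
  have hv' : ∀ j, ∑ i, v i * hess h x i j = 0 := fun j => congrFun hv j
  have hg : ∑ i, v i * pd i h x = 0 := by
    have : (d - 1) * ∑ i, v i * pd i h x = 0 := by
      calc (d - 1) * ∑ i, v i * pd i h x = ∑ i, v i * ∑ j, hess h x i j * x j := by
            rw [Finset.mul_sum]
            refine Finset.sum_congr rfl fun i _ => ?_
            rw [hE]; ring
        _ = ∑ j, (∑ i, v i * hess h x i j) * x j := by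
            simp_rw [Finset.mul_sum, Finset.sum_mul]
            rw [Finset.sum_comm]
            simp_rw [mul_assoc]
        _ = 0 := by simp [hv']
    exact (mul_eq_zero.mp this).resolve_left (sub_ne_zero.mpr hd1)
  refine Matrix.exists_vecMul_eq_zero_iff.mp ⟨v, hv0, ?_⟩
  funext j
  show ∑ i, v i * hess (fun y => F (h y)) x i j = 0
  calc ∑ i, v i * hess (fun y => F (h y)) x i j
      = deriv (deriv F) (h x) * pd j h x * ∑ i, v i * pd i h x
        + deriv F (h x) * ∑ i, v i * hess h x i j := by
        rw [Finset.mul_sum, Finset.mul_sum, ← Finset.sum_add_distrib]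
        refine Finset.sum_congr rfl fun i _ => ?_
        rw [hf]; ring
    _ = 0 := by rw [hg, hv']; ring
end

section
/- Let n ≥ 2, let h : ℝⁿ₊ → ℝ₊ be a twice continuously differentiable function that is homogeneous of degree d with d ≠ 0 and d ≠ 1, and let F : ℝ₊ → ℝ be twice continuously differentiable with F′ ≠ 0 everywhere. If f = F ∘ h satisfies the homogeneous Monge–Ampère equation det(f_ij) = 0 at every point of ℝⁿ₊, then either (i) h satisfies det(h_ij) = 0 at every point of ℝⁿ₊, or (ii) there exist real numbers α ≠ 0 and β such that F(u) = α·u^{1/d} + β on the range of h, so that f − β is homogeneous of degree 1. -/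
open Real

theorem posOrth_smul {n : ℕ} {t : ℝ} (ht : 0 < t) {x : Fin n → ℝ} (hx : x ∈ posOrth n) :
    t • x ∈ posOrth n := fun i => mul_pos ht (hx i)

theorem pd_homog {n : ℕ} (k : (Fin n → ℝ) → ℝ) (e : ℝ)
    (hk : ∀ x ∈ posOrth n, DifferentiableAt ℝ k x)
    (hh : ∀ t : ℝ, 0 < t → ∀ x ∈ posOrth n, k (t • x) = t ^ e * k x) (j : Fin n) :
    ∀ t : ℝ, 0 < t → ∀ x ∈ posOrth n, pd j k (t • x) = t ^ (e - 1) * pd j k x := by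
  intro t ht x hx
  have h1 : (fun y => k (t • y)) =ᶠ[nhds x] fun y => t ^ e * k y := by
    filter_upwards [(posOrth_open n).mem_nhds hx] with y hy using hh t ht y hy
  have h2 := h1.fderiv_eq (𝕜 := ℝ)
  have h3 : HasFDerivAt (fun y => k (t • y))
      ((fderiv ℝ k (t • x)).comp (t • ContinuousLinearMap.id ℝ (Fin n → ℝ))) x :=
    HasFDerivAt.comp x (hk _ (posOrth_smul ht hx)).hasFDerivAt
      ((hasFDerivAt_id x).const_smul t)
  have h4 : HasFDerivAt (fun y => t ^ e * k y) (t ^ e • fderiv ℝ k x) x :=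
    (hk x hx).hasFDerivAt.const_mul _
  rw [h3.fderiv, h4.fderiv] at h2
  have h5 := DFunLike.congr_fun h2 (Pi.single j 1)
  simp only [ContinuousLinearMap.comp_apply, ContinuousLinearMap.smul_apply,
    ContinuousLinearMap.id_apply, map_smul, smul_eq_mul] at h5
  unfold pd
  rw [Real.rpow_sub_one ht.ne']
  field_simp
  linarith

theorem euler_homog {n : ℕ} (k : (Fin n → ℝ) → ℝ) (e : ℝ)
    (hk : ∀ x ∈ posOrth n, DifferentiableAt ℝ k x)
    (hh : ∀ t : ℝ, 0 < t → ∀ x ∈ posOrth n, k (t • x) = t ^ e * k x) :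
    ∀ x ∈ posOrth n, ∑ i, x i * pd i k x = e * k x := by
  intro x hx
  have h1 : (fun t : ℝ => k (t • x)) =ᶠ[nhds 1] fun t => t ^ e * k x := by
    filter_upwards [lt_mem_nhds (zero_lt_one (α := ℝ))] with t ht using hh t ht x hx
  have h2 := h1.deriv_eq
  have h0 : HasFDerivAt k (fderiv ℝ k x) ((1 : ℝ) • x) := by
    rw [one_smul]; exact (hk x hx).hasFDerivAt
  have hs : HasDerivAt (fun t : ℝ => t • x) ((1 : ℝ) • x) 1 := (hasDerivAt_id (1 : ℝ)).smul_const x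
  have h3 : HasDerivAt (fun t : ℝ => k (t • x)) (fderiv ℝ k x ((1 : ℝ) • x)) 1 :=
    h0.comp_hasDerivAt (1 : ℝ) hs
  have h4 : HasDerivAt (fun t : ℝ => t ^ e * k x) (e * (1 : ℝ) ^ (e - 1) * k x) 1 :=
    (Real.hasDerivAt_rpow_const (Or.inl one_ne_zero)).mul_const _
  rw [h3.deriv, h4.deriv, one_smul, Real.one_rpow, mul_one] at h2
  rw [← h2]
  conv_rhs => rw [pi_eq_sum_univ' x]
  rw [map_sum]
  refine Finset.sum_congr rfl fun i _ => ?_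
  rw [map_smul, smul_eq_mul, pd, ← pi_eq_sum_univ' x]

theorem F_solve (d : ℝ) (hd0 : d ≠ 0) (F : ℝ → ℝ) (hFC2 : ContDiffOn ℝ 2 F (Set.Ioi (0 : ℝ)))
    (hF' : ∀ u : ℝ, 0 < u → deriv F u ≠ 0)
    (hode : ∀ u : ℝ, 0 < u → deriv (deriv F) u * (d * u) + (d - 1) * deriv F u = 0) :
    ∃ α β : ℝ, α ≠ 0 ∧ ∀ u : ℝ, 0 < u → F u = α * u ^ (1 / d) + β := by
  have hF1 : ∀ u : ℝ, 0 < u → HasDerivAt F (deriv F u) u := fun u hu =>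
    ((hFC2.differentiableOn (by norm_num)).differentiableAt (Ioi_mem_nhds hu)).hasDerivAt
  have hF2 : ∀ u : ℝ, 0 < u → HasDerivAt (deriv F) (deriv (deriv F) u) u := fun u hu =>
    ((((contDiffOn_succ_iff_deriv_of_isOpen (n := 1) isOpen_Ioi).1
      (by simpa [one_add_one_eq_two] using hFC2)).2.2.differentiableOn
        (by norm_num)).differentiableAt (Ioi_mem_nhds hu)).hasDerivAt
  have hconst : ∀ G G' : ℝ → ℝ, (∀ u : ℝ, 0 < u → HasDerivAt G (G' u) u) →
      (∀ u : ℝ, 0 < u → G' u = 0) → ∀ u : ℝ, 0 < u → G u = G 1 := by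
    intro G G' hG hG' u hu
    refine isOpen_Ioi.is_const_of_deriv_eq_zero (s := Set.Ioi (0 : ℝ))
      (convex_Ioi (0 : ℝ)).isPreconnected ?_ ?_ hu (Set.mem_Ioi.2 one_pos)
    · intro v hv
      exact (hG v hv).differentiableAt.differentiableWithinAt
    · intro v hv
      rw [(hG v hv).deriv, hG' v hv]; rfl
  have hG1 := hconst (fun u => deriv F u * u ^ (1 - 1 / d)) _
    (fun u hu => (hF2 u hu).mul (Real.hasDerivAt_rpow_const (p := 1 - 1 / d) (Or.inl hu.ne')))
    (by
      intro u hu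
      have := hode u hu
      rw [Real.rpow_sub_one hu.ne']
      have hp := (Real.rpow_pos_of_pos hu (1 - 1 / d)).ne'
      field_simp
      linear_combination u ^ ((d - 1) / d) * this)
  have hF'eq : ∀ u : ℝ, 0 < u → deriv F u = deriv F 1 * u ^ (1 / d - 1) := by
    intro u hu
    have h1 := hG1 u hu
    simp only [Real.one_rpow, mul_one] at h1
    rw [← h1, mul_assoc, ← Real.rpow_add hu]
    simp
  have hG2 := hconst (fun u => F u - deriv F 1 * d * u ^ (1 / d)) _
    (fun u hu => (hF1 u hu).sub
      ((Real.hasDerivAt_rpow_const (p := 1 / d) (Or.inl hu.ne')).const_mul (deriv F 1 * d)))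
    (by
      intro u hu
      rw [hF'eq u hu]
      field_simp
      ring)
  refine ⟨deriv F 1 * d, F 1 - deriv F 1 * d * 1 ^ (1 / d), mul_ne_zero (hF' 1 one_pos) hd0, ?_⟩
  intro u hu
  have := hG2 u hu
  linarith

theorem det_formula {n : ℕ} (d : ℝ) (hd1 : d ≠ 1) (a b hx : ℝ) (ha : a ≠ 0)
    (H K : Matrix (Fin n) (Fin n) ℝ) (g x : Fin n → ℝ)
    (hK : ∀ i j, K i j = b * g i * g j + a * H i j)
    (hxg : ∑ i, x i * g i = d * hx)
    (hxH : ∀ j, ∑ i, x i * H i j = (d - 1) * g j) (hdet : K.det = 0) (hH : H.det ≠ 0) :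
    b * (d * hx) + (d - 1) * a = 0 := by
  have hd : d - 1 ≠ 0 := sub_ne_zero.2 hd1
  have hfac : K = a • ((1 + Matrix.replicateCol Unit ((b / (a * (d - 1))) • g) *
      Matrix.replicateRow Unit x) * H) := by
    ext i j
    rw [hK, Matrix.add_mul, Matrix.one_mul, Matrix.mul_assoc]
    simp only [Matrix.smul_apply, Matrix.add_apply, Matrix.mul_apply, Matrix.replicateCol_apply,
      Matrix.replicateRow_apply, Finset.univ_unique, Finset.sum_singleton, hxH, Pi.smul_apply,
      smul_eq_mul]
    field_simp
    ring
  rw [hfac, Matrix.det_smul, Matrix.det_mul, Matrix.det_one_add_replicateCol_mul_replicateRow]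
    at hdet
  have h1 : 1 + x ⬝ᵥ ((b / (a * (d - 1))) • g) = 0 := by
    rcases mul_eq_zero.1 hdet with h | h
    · exact absurd h (pow_ne_zero _ ha)
    · exact (mul_eq_zero.1 h).resolve_right hH
  rw [dotProduct_smul] at h1
  have h2 : x ⬝ᵥ g = d * hx := hxg
  rw [h2, smul_eq_mul] at h1
  field_simp at h1
  linear_combination h1

/-- If `h : ℝⁿ₊ → ℝ₊` is C², homogeneous of degree `d` (`d ≠ 0`, `d ≠ 1`),
`F : ℝ₊ → ℝ` is C² with `F′ ≠ 0`, and `f = F ∘ h` satisfies `det(f_ij) = 0` on `ℝⁿ₊`,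
then either (i) `det(h_ij) = 0` on `ℝⁿ₊`, or (ii) there are `α ≠ 0`, `β` with
`F(u) = α·u^(1/d) + β` on the range of `h`, so that `f − β` is homogeneous of degree 1. -/
theorem stmt_1 {n : ℕ} (hn : 2 ≤ n) (d : ℝ) (hd0 : d ≠ 0) (hd1 : d ≠ 1)
    (h : (Fin n → ℝ) → ℝ)
    (hC2 : ContDiffOn ℝ 2 h (posOrth n))
    (hpos : ∀ x ∈ posOrth n, 0 < h x)
    (hhom : ∀ t : ℝ, 0 < t → ∀ x ∈ posOrth n, h (t • x) = t ^ d * h x)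
    (F : ℝ → ℝ) (hFC2 : ContDiffOn ℝ 2 F (Set.Ioi (0 : ℝ)))
    (hF' : ∀ u : ℝ, 0 < u → deriv F u ≠ 0)
    (hfMA : ∀ x ∈ posOrth n, hessDet (fun y => F (h y)) x = 0) :
    (∀ x ∈ posOrth n, hessDet h x = 0) ∨
    (∃ α β : ℝ, α ≠ 0 ∧ (∀ u ∈ h '' posOrth n, F u = α * u ^ (1 / d) + β) ∧
      (∀ t : ℝ, 0 < t → ∀ x ∈ posOrth n, F (h (t • x)) - β = t * (F (h x) - β))) := by
  have hopen := posOrth_open n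
  have hh1 : ∀ x ∈ posOrth n, DifferentiableAt ℝ h x := fun x hx =>
    (hC2.differentiableOn (by norm_num)).differentiableAt (hopen.mem_nhds hx)
  have hh2 : ∀ j, ∀ x ∈ posOrth n, DifferentiableAt ℝ (pd j h) x := by
    intro j x hx
    have h1 : DifferentiableAt ℝ (fderiv ℝ h) x :=
      (((contDiffOn_succ_iff_fderiv_of_isOpen (n := 1) hopen).1
        (by simpa [one_add_one_eq_two] using hC2)).2.2.differentiableOn
          (by norm_num)).differentiableAt (hopen.mem_nhds hx)
    exact h1.clm_apply (differentiableAt_const _)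
  have hF1 : ∀ u : ℝ, 0 < u → HasDerivAt F (deriv F u) u := fun u hu =>
    ((hFC2.differentiableOn (by norm_num)).differentiableAt (Ioi_mem_nhds hu)).hasDerivAt
  have hF2 : ∀ u : ℝ, 0 < u → HasDerivAt (deriv F) (deriv (deriv F) u) u := fun u hu =>
    ((((contDiffOn_succ_iff_deriv_of_isOpen (n := 1) isOpen_Ioi).1
      (by simpa [one_add_one_eq_two] using hFC2)).2.2.differentiableOn
        (by norm_num)).differentiableAt (Ioi_mem_nhds hu)).hasDerivAt
  have hpd1 := pd_homog h d hh1 hhom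
  have hpd2 := fun j => pd_homog (pd j h) (d - 1) (hh2 j) (hpd1 j)
  have hK : ∀ x ∈ posOrth n, ∀ i j, hess (fun y => F (h y)) x i j =
      deriv (deriv F) (h x) * pd i h x * pd j h x + deriv F (h x) * hess h x i j := by
    intro x hx i j
    have h1 : pd j (fun y => F (h y)) =ᶠ[nhds x] fun y => deriv F (h y) * pd j h y := by
      filter_upwards [hopen.mem_nhds hx] with y hy
      have := (hF1 _ (hpos y hy)).comp_hasFDerivAt y (hh1 y hy).hasFDerivAt
      have h2 : fderiv ℝ (fun y => F (h y)) y = deriv F (h y) • fderiv ℝ h y := this.fderiv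
      simp [pd, h2]
    have h3 : HasFDerivAt (fun y => deriv F (h y)) (deriv (deriv F) (h x) • fderiv ℝ h x) x :=
      (hF2 _ (hpos x hx)).comp_hasFDerivAt x (hh1 x hx).hasFDerivAt
    have h4 := h3.mul (hh2 j x hx).hasFDerivAt
    have h5 : fderiv ℝ (pd j (fun y => F (h y))) x = _ := h1.fderiv_eq.trans h4.fderiv
    have h6 : hess (fun y => F (h y)) x i j
        = fderiv ℝ (pd j (fun y => F (h y))) x (Pi.single i 1) := rfl
    have h7 : hess h x i j = fderiv ℝ (pd j h) x (Pi.single i 1) := rfl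
    rw [h6, h7, h5]
    simp only [ContinuousLinearMap.add_apply, ContinuousLinearMap.smul_apply, smul_eq_mul]
    have h8 : fderiv ℝ h x (Pi.single i 1) = pd i h x := rfl
    rw [h8]
    ring
  have key : ∀ x ∈ posOrth n, hessDet h x ≠ 0 →
      deriv (deriv F) (h x) * (d * h x) + (d - 1) * deriv F (h x) = 0 := by
    intro x hx hne
    exact det_formula d hd1 (deriv F (h x)) _ (h x) (hF' _ (hpos x hx)) (hess h x)
      (hess (fun y => F (h y)) x) (fun i => pd i h x) x (hK x hx)
      (euler_homog h d hh1 hhom x hx)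
      (fun j => euler_homog (pd j h) (d - 1) (hh2 j) (hpd1 j) x hx) (hfMA x hx) hne
  by_cases hall : ∀ x ∈ posOrth n, hessDet h x = 0
  · exact Or.inl hall
  right
  push Not at hall
  obtain ⟨x, hx, hne⟩ := hall
  have hne' : ∀ t : ℝ, 0 < t → hessDet h (t • x) ≠ 0 := by
    intro t ht
    have h1 : hess h (t • x) = t ^ (d - 1 - 1) • hess h x := by
      ext i j
      exact hpd2 j i t ht x hx
    rw [hessDet, h1, Matrix.det_smul]
    exact mul_ne_zero (pow_ne_zero _ (Real.rpow_pos_of_pos ht _).ne') hne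
  obtain ⟨α, β, hα, hsol⟩ := F_solve d hd0 F hFC2 hF' (by
    intro u hu
    have hq : 0 < u / h x := div_pos hu (hpos x hx)
    have ht : 0 < (u / h x) ^ (1 / d) := Real.rpow_pos_of_pos hq _
    have h1 : h (((u / h x) ^ (1 / d)) • x) = u := by
      rw [hhom _ ht x hx, ← Real.rpow_mul hq.le, one_div_mul_cancel hd0, Real.rpow_one]
      exact div_mul_cancel₀ _ (hpos x hx).ne'
    have := key _ (posOrth_smul ht hx) (hne' _ ht)
    rwa [h1] at this)
  refine ⟨α, β, hα, ?_, ?_⟩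
  · rintro u ⟨y, hy, rfl⟩
    exact hsol _ (hpos y hy)
  · intro t ht y hy
    rw [hsol _ (hpos _ (posOrth_smul ht hy)), hsol _ (hpos y hy), hhom t ht y hy,
      Real.mul_rpow (Real.rpow_pos_of_pos ht _).le (hpos y hy).le, ← Real.rpow_mul ht.le,
      mul_one_div_cancel hd0, Real.rpow_one]
    ring
end

section
/- Let h : ℝ²₊ → ℝ₊ be a twice continuously differentiable function that is homogeneous of degree d ≠ 0, and let F : ℝ₊ → ℝ be twice continuously differentiable with F′ ≠ 0 everywhere. Then f(x,y) = F(h(x,y)) satisfies the homogeneous Monge–Ampère equation det(f_ij) = 0 at every point of ℝ²₊ if and only if either (1) there exist real constants a, b such that h(x,y) = (a·x + b·y)^d on ℝ²₊, or (2) there exists a constant β such that f − β is homogeneous of degree 1. -/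
open Real

lemma isOpen_posOrth2 : IsOpen (posOrth 2) := by
  have : posOrth 2 = ⋂ i : Fin 2, {x : Fin 2 → ℝ | 0 < x i} := by
    ext x; simp [posOrth]
  rw [this]
  exact isOpen_iInter_of_finite fun i => isOpen_lt continuous_const (continuous_apply i)

lemma convex_posOrth2 : Convex ℝ (posOrth 2) := by
  have : posOrth 2 = ⋂ i : Fin 2, {x : Fin 2 → ℝ | 0 < x i} := by
    ext x; simp [posOrth]
  rw [this]
  exact convex_iInter fun i => convex_halfSpace_gt (LinearMap.isLinear (LinearMap.proj i)) 0

lemma smul_posOrth2 {t : ℝ} (ht : 0 < t) {x : Fin 2 → ℝ} (hx : x ∈ posOrth 2) :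
    t • x ∈ posOrth 2 := fun i => by
  simpa using mul_pos ht (hx i)

lemma diff_of_C2 {f : (Fin 2 → ℝ) → ℝ} (hf : ContDiffOn ℝ 2 f (posOrth 2))
    {x : Fin 2 → ℝ} (hx : x ∈ posOrth 2) : DifferentiableAt ℝ f x :=
  (hf.differentiableOn (by norm_num)).differentiableAt (isOpen_posOrth2.mem_nhds hx)

lemma pd_diff {f : (Fin 2 → ℝ) → ℝ} (hf : ContDiffOn ℝ 2 f (posOrth 2))
    {x : Fin 2 → ℝ} (hx : x ∈ posOrth 2) (j : Fin 2) : DifferentiableAt ℝ (pd j f) x := by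
  have h1 : ContDiffOn ℝ 1 (fderiv ℝ f) (posOrth 2) :=
    hf.fderiv_of_isOpen isOpen_posOrth2 (by norm_num)
  have h2 : DifferentiableAt ℝ (fderiv ℝ f) x :=
    (h1.differentiableOn (by norm_num)).differentiableAt (isOpen_posOrth2.mem_nhds hx)
  unfold pd
  fun_prop

lemma pd_congr {f g : (Fin 2 → ℝ) → ℝ} (hfg : ∀ x ∈ posOrth 2, f x = g x)
    {x : Fin 2 → ℝ} (hx : x ∈ posOrth 2) (j : Fin 2) : pd j f x = pd j g x := by
  have : f =ᶠ[nhds x] g := by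
    filter_upwards [isOpen_posOrth2.mem_nhds hx] with y hy using hfg y hy
  unfold pd
  rw [this.fderiv_eq]

lemma fderiv_eq_pd (f : (Fin 2 → ℝ) → ℝ) (x v : Fin 2 → ℝ) :
    fderiv ℝ f x v = v 0 * pd 0 f x + v 1 * pd 1 f x := by
  have : v = v 0 • Pi.single 0 1 + v 1 • Pi.single 1 1 := by
    ext i; fin_cases i <;> simp
  conv_lhs => rw [this]
  simp [pd]

lemma pd_symm {f : (Fin 2 → ℝ) → ℝ} (hf : ContDiffOn ℝ 2 f (posOrth 2))
    {x : Fin 2 → ℝ} (hx : x ∈ posOrth 2) (i j : Fin 2) :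
    pd i (pd j f) x = pd j (pd i f) x := by
  have h1 : ContDiffOn ℝ 1 (fderiv ℝ f) (posOrth 2) :=
    hf.fderiv_of_isOpen isOpen_posOrth2 (by norm_num)
  have h2 : DifferentiableAt ℝ (fderiv ℝ f) x :=
    (h1.differentiableOn (by norm_num)).differentiableAt (isOpen_posOrth2.mem_nhds hx)
  have hs : IsSymmSndFDerivAt ℝ f x :=
    (hf.contDiffAt (isOpen_posOrth2.mem_nhds hx)).isSymmSndFDerivAt (by simp)
  have key : ∀ i j : Fin 2, pd i (pd j f) x =
      fderiv ℝ (fderiv ℝ f) x (Pi.single i 1) (Pi.single j 1) := by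
    intro i j
    show fderiv ℝ (fun y => fderiv ℝ f y (Pi.single j 1)) x (Pi.single i 1) = _
    rw [fderiv_clm_apply h2 (differentiableAt_const _)]
    simp
  rw [key, key]
  exact hs _ _

lemma hessDet_eq (f : (Fin 2 → ℝ) → ℝ) (x : Fin 2 → ℝ) :
    hessDet f x = pd 0 (pd 0 f) x * pd 1 (pd 1 f) x - pd 0 (pd 1 f) x * pd 1 (pd 0 f) x := by
  unfold hessDet
  rw [Matrix.det_fin_two]
  rfl

lemma det_zero_of {A B C D p q : ℝ} (hpq : p ≠ 0 ∨ q ≠ 0) (h0 : p * A + q * B = 0)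
    (h1 : p * C + q * D = 0) : A * D - B * C = 0 := by
  rcases hpq with hp | hq
  · apply mul_left_cancel₀ hp; linear_combination D * h0 - B * h1
  · apply mul_left_cancel₀ hq; linear_combination A * h1 - C * h0

/-- Euler's identity for functions which are affinely homogeneous of degree one. -/
lemma euler {f : (Fin 2 → ℝ) → ℝ} (hf : ContDiffOn ℝ 2 f (posOrth 2)) (β : ℝ)
    (hh : ∀ t : ℝ, 0 < t → ∀ x ∈ posOrth 2, f (t • x) - β = t * (f x - β))
    {x : Fin 2 → ℝ} (hx : x ∈ posOrth 2) :
    x 0 * pd 0 f x + x 1 * pd 1 f x = f x - β := by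
  rw [← fderiv_eq_pd]
  have hd := (diff_of_C2 hf hx).hasFDerivAt
  have hl : HasDerivAt (fun t : ℝ => t • x) x 1 := by
    simpa using (hasDerivAt_id (1:ℝ)).smul_const x
  have hd' : HasFDerivAt f (fderiv ℝ f x) ((1:ℝ) • x) := by simpa using hd
  have hc : HasDerivAt (fun t : ℝ => f (t • x)) (fderiv ℝ f x x) 1 :=
    hd'.comp_hasDerivAt 1 hl
  have hr : HasDerivAt (fun t : ℝ => t * (f x - β) + β) (f x - β) 1 := by
    simpa using ((hasDerivAt_id (1:ℝ)).mul_const (f x - β)).add_const β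
  have he : (fun t : ℝ => f (t • x)) =ᶠ[nhds 1] (fun t : ℝ => t * (f x - β) + β) := by
    filter_upwards [lt_mem_nhds (zero_lt_one : (0:ℝ) < 1)] with t ht
    linarith [hh t ht x hx]
  exact hc.unique (hr.congr_of_eventuallyEq he)

lemma euler2 {f : (Fin 2 → ℝ) → ℝ} (hf : ContDiffOn ℝ 2 f (posOrth 2)) (β : ℝ)
    (hh : ∀ t : ℝ, 0 < t → ∀ x ∈ posOrth 2, f (t • x) - β = t * (f x - β))
    {x : Fin 2 → ℝ} (hx : x ∈ posOrth 2) (i : Fin 2) :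
    x 0 * pd i (pd 0 f) x + x 1 * pd i (pd 1 f) x = 0 := by
  have h1 := pd_congr (f := fun x => x 0 * pd 0 f x + x 1 * pd 1 f x) (g := fun x => f x - β)
    (fun x hx => euler hf β hh hx) hx i
  have hp : ∀ k : Fin 2, HasFDerivAt (fun y : Fin 2 → ℝ => y k)
      (ContinuousLinearMap.proj (R := ℝ) (φ := fun _ : Fin 2 => ℝ) k) x := fun k =>
    (ContinuousLinearMap.proj (R := ℝ) (φ := fun _ : Fin 2 => ℝ) k).hasFDerivAt
  have h2 := ((hp 0).mul (pd_diff hf hx 0).hasFDerivAt).add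
    ((hp 1).mul (pd_diff hf hx 1).hasFDerivAt)
  have h3 := (diff_of_C2 hf hx).hasFDerivAt.sub_const β
  have h4 : pd i (fun x => x 0 * pd 0 f x + x 1 * pd 1 f x) x = _ :=
    congrArg (fun L => L (Pi.single i 1)) h2.fderiv
  have h5 : pd i (fun x => f x - β) x = _ :=
    congrArg (fun L => L (Pi.single i 1)) h3.fderiv
  rw [h4, h5] at h1
  change _ = pd i f x at h1
  simp only [ContinuousLinearMap.add_apply, ContinuousLinearMap.smul_apply, smul_eq_mul,
    ContinuousLinearMap.proj_apply] at h1
  change x 0 * pd i (pd 0 f) x + _ + (x 1 * pd i (pd 1 f) x + _) = _ at h1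
  fin_cases i <;> simp at h1 ⊢ <;> linarith

/-- Case (2) implies the equation. -/
lemma det_zero_of_hom {f : (Fin 2 → ℝ) → ℝ} (hf : ContDiffOn ℝ 2 f (posOrth 2)) (β : ℝ)
    (hh : ∀ t : ℝ, 0 < t → ∀ x ∈ posOrth 2, f (t • x) - β = t * (f x - β))
    {x : Fin 2 → ℝ} (hx : x ∈ posOrth 2) : hessDet f x = 0 := by
  rw [hessDet_eq]
  exact det_zero_of (Or.inl (hx 0).ne') (euler2 hf β hh hx 0) (euler2 hf β hh hx 1)

/-- Case (1) implies the equation. -/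
lemma det_zero_of_lin {f : (Fin 2 → ℝ) → ℝ} (hf : ContDiffOn ℝ 2 f (posOrth 2)) (a b : ℝ)
    (hab : b ≠ 0 ∨ -a ≠ 0) (G : ℝ → ℝ)
    (hG : ∀ x ∈ posOrth 2, f x = G (a * x 0 + b * x 1))
    {x : Fin 2 → ℝ} (hx : x ∈ posOrth 2) : hessDet f x = 0 := by
  have h1 : ∀ x ∈ posOrth 2, b * pd 0 f x + (-a) * pd 1 f x = 0 := by
    intro x hx
    have hv := fderiv_eq_pd f x ![b, -a]
    simp only [Matrix.cons_val_zero, Matrix.cons_val_one] at hv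
    rw [← hv]
    have hl : HasDerivAt (fun t : ℝ => x + t • (![b, -a] : Fin 2 → ℝ)) ![b, -a] 0 := by
      simpa using ((hasDerivAt_id (0:ℝ)).smul_const (![b, -a] : Fin 2 → ℝ)).const_add x
    have hd : HasFDerivAt f (fderiv ℝ f x) (x + (0:ℝ) • (![b, -a] : Fin 2 → ℝ)) := by
      simpa using (diff_of_C2 hf hx).hasFDerivAt
    have hc := hd.comp_hasDerivAt 0 hl
    have hm : ∀ᶠ t in nhds (0:ℝ), x + t • (![b, -a] : Fin 2 → ℝ) ∈ posOrth 2 :=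
      hl.continuousAt.eventually_mem (isOpen_posOrth2.mem_nhds (by simpa using hx))
    have he : (f ∘ fun t : ℝ => x + t • (![b, -a] : Fin 2 → ℝ)) =ᶠ[nhds 0] fun _ => f x := by
      filter_upwards [hm] with t ht
      simp only [Function.comp]
      rw [hG _ ht, hG x hx]
      congr 1
      simp
      ring
    exact hc.unique ((hasDerivAt_const (0:ℝ) (f x)).congr_of_eventuallyEq he)
  have h2 : ∀ i, b * pd i (pd 0 f) x + (-a) * pd i (pd 1 f) x = 0 := by
    intro i
    have h1' := pd_congr (f := fun x => b * pd 0 f x + (-a) * pd 1 f x) (g := fun _ => 0) h1 hx i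
    have h3 := ((pd_diff hf hx 0).hasFDerivAt.const_mul b).add
      ((pd_diff hf hx 1).hasFDerivAt.const_mul (-a))
    have h4 : pd i (fun x => b * pd 0 f x + (-a) * pd 1 f x) x = _ :=
      congrArg (fun L => L (Pi.single i 1)) h3.fderiv
    rw [h4] at h1'
    have h5 : pd i (fun _ => (0:ℝ)) x = 0 := by simp [pd]
    rw [h5] at h1'
    exact h1'
  rw [hessDet_eq]
  exact det_zero_of hab (h2 0) (h2 1)

lemma pd_comp {g : (Fin 2 → ℝ) → ℝ} {G : ℝ → ℝ} {x : Fin 2 → ℝ} (hG : DifferentiableAt ℝ G (g x))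
    (hg : DifferentiableAt ℝ g x) (i : Fin 2) :
    pd i (fun y => G (g y)) x = deriv G (g x) * pd i g x := by
  have := congrArg (fun L => L (Pi.single i 1))
    (hG.hasDerivAt.comp_hasFDerivAt x hg.hasFDerivAt).fderiv
  exact this

lemma pd_pd_comp {g : (Fin 2 → ℝ) → ℝ} {G : ℝ → ℝ} (hg : ContDiffOn ℝ 2 g (posOrth 2))
    (hgpos : ∀ x ∈ posOrth 2, 0 < g x) (hG : ContDiffOn ℝ 2 G (Set.Ioi 0))
    {x : Fin 2 → ℝ} (hx : x ∈ posOrth 2) (i j : Fin 2) :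
    pd i (pd j (fun y => G (g y))) x =
      deriv (deriv G) (g x) * pd i g x * pd j g x + deriv G (g x) * pd i (pd j g) x := by
  have hG1 : ∀ s : ℝ, 0 < s → DifferentiableAt ℝ G s := fun s hs =>
    (hG.differentiableOn (by norm_num)).differentiableAt (isOpen_Ioi.mem_nhds hs)
  have hG2 : DifferentiableAt ℝ (deriv G) (g x) :=
    (((hG.deriv_of_isOpen (m := 1) isOpen_Ioi (by norm_num)).differentiableOn
      (by norm_num))).differentiableAt (isOpen_Ioi.mem_nhds (hgpos x hx))
  rw [pd_congr (g := fun y => deriv G (g y) * pd j g y)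
    (fun y hy => pd_comp (hG1 _ (hgpos y hy)) (diff_of_C2 hg hy) j) hx i]
  have h1 := (hG2.hasDerivAt.comp_hasFDerivAt x (diff_of_C2 hg hx).hasFDerivAt).mul
    (pd_diff hg hx j).hasFDerivAt
  have h2 : pd i (fun y => deriv G (g y) * pd j g y) x = _ :=
    congrArg (fun L => L (Pi.single i 1)) h1.fderiv
  rw [h2]
  change deriv G (g x) * pd i (pd j g) x + pd j g x * (deriv (deriv G) (g x) * pd i g x) = _
  ring

lemma pd_scale {k : (Fin 2 → ℝ) → ℝ} {t c : ℝ}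
    (hk : ∀ x ∈ posOrth 2, k (t • x) = c * k x)
    {x : Fin 2 → ℝ} (hx : x ∈ posOrth 2) (hkd : DifferentiableAt ℝ k x) (i : Fin 2) :
    t * pd i k (t • x) = c * pd i k x := by
  have h1 := pd_congr (f := fun x => k (t • x)) (g := fun x => c * k x) hk hx i
  have h2 : pd i (fun x => k (t • x)) x = t * pd i k (t • x) := by
    unfold pd
    rw [fderiv_comp_smul]
    simp
  have h3 : pd i (fun x => c * k x) x = c * pd i k x :=
    congrArg (fun L => L (Pi.single i 1)) (hkd.hasFDerivAt.const_mul c).fderiv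
  rw [← h2, h1, h3]

lemma const_of_pd {k : (Fin 2 → ℝ) → ℝ} (hk : ∀ x ∈ posOrth 2, DifferentiableAt ℝ k x)
    (h0 : ∀ x ∈ posOrth 2, ∀ i, pd i k x = 0) {x y : Fin 2 → ℝ} (hx : x ∈ posOrth 2)
    (hy : y ∈ posOrth 2) : k x = k y := by
  refine isOpen_posOrth2.is_const_of_fderiv_eq_zero convex_posOrth2.isPreconnected
    (fun z hz => (hk z hz).differentiableWithinAt) ?_ hx hy
  intro z hz
  ext v
  simp [fderiv_eq_pd, h0 z hz]

/-- The core dichotomy, for a degree one function `g`. -/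
lemma core {g : (Fin 2 → ℝ) → ℝ} {G : ℝ → ℝ} (hg : ContDiffOn ℝ 2 g (posOrth 2))
    (hgpos : ∀ x ∈ posOrth 2, 0 < g x) (hG : ContDiffOn ℝ 2 G (Set.Ioi 0))
    (hG' : ∀ s : ℝ, 0 < s → deriv G s ≠ 0)
    (hh : ∀ t : ℝ, 0 < t → ∀ x ∈ posOrth 2, g (t • x) = t * g x)
    (hdet : ∀ x ∈ posOrth 2, hessDet (fun y => G (g y)) x = 0) :
    (∃ a b : ℝ, ∀ x ∈ posOrth 2, g x = a * x 0 + b * x 1) ∨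
    (∃ α β : ℝ, ∀ s : ℝ, 0 < s → G s = α * s + β) := by
  have hh' : ∀ t : ℝ, 0 < t → ∀ x ∈ posOrth 2, g (t • x) - 0 = t * (g x - 0) := by
    simpa using hh
  have hG1 : ∀ s : ℝ, 0 < s → DifferentiableAt ℝ G s := fun s hs =>
    (hG.differentiableOn (by norm_num)).differentiableAt (isOpen_Ioi.mem_nhds hs)
  have hG2 : ∀ s : ℝ, 0 < s → DifferentiableAt ℝ (deriv G) s := fun s hs =>
    (((hG.deriv_of_isOpen (m := 1) isOpen_Ioi (by norm_num)).differentiableOn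
      (by norm_num))).differentiableAt (isOpen_Ioi.mem_nhds hs)
  have key : ∀ x ∈ posOrth 2, deriv (deriv G) (g x) * pd 0 (pd 0 g) x = 0 := by
    intro x hx
    have h := hdet x hx
    rw [hessDet_eq] at h
    simp only [pd_pd_comp hg hgpos hG hx] at h
    have e := euler hg 0 hh' hx
    have e0 := euler2 hg 0 hh' hx 0
    have e1 := euler2 hg 0 hh' hx 1
    have hs := pd_symm hg hx 1 0
    rw [hs] at e1 h
    have hx0 := hx 0
    have hx1 := hx 1
    have hgx := hgpos x hx
    have hGx := hG' _ hgx
    generalize pd 0 (pd 0 g) x = A at *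
    generalize pd 0 (pd 1 g) x = B at *
    generalize pd 1 (pd 1 g) x = D at *
    generalize pd 0 g x = p at *
    generalize pd 1 g x = q at *
    generalize deriv (deriv G) (g x) = K at *
    generalize deriv G (g x) = L at *
    generalize g x = w at *
    generalize x 0 = u at *
    generalize x 1 = v at *
    have hB : B = -(u * A) / v := by field_simp; linarith
    have hD : D = u ^ 2 * A / v ^ 2 := by
      field_simp
      have : D * v = -(u * B) := by linarith
      rw [pow_two, ← mul_assoc, this]
      linear_combination (-u) * e0
    rw [hB, hD] at h
    have hw : w = u * p + v * q := by linarith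
    have h6 : L * w ^ 2 * (K * A) = 0 := by
      rw [hw]
      field_simp at h
      first
        | linear_combination h
        | linear_combination v * h
        | linear_combination v ^ 2 * h
        | (apply mul_left_cancel₀ hx1.ne'; linear_combination h)
        | (apply mul_left_cancel₀ hGx; linear_combination h)
        | (apply mul_left_cancel₀ hGx; linear_combination L * h)
    exact (mul_eq_zero.mp h6).resolve_left (mul_ne_zero hGx (pow_ne_zero 2 hgx.ne'))
  by_cases hc : ∀ s : ℝ, 0 < s → deriv (deriv G) s = 0
  · right
    have hconst : ∀ s ∈ Set.Ioi (0:ℝ), deriv G s = deriv G 1 := fun s hs =>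
      isOpen_Ioi.is_const_of_deriv_eq_zero (convex_Ioi 0).isPreconnected
        (fun z hz => (hG2 z hz).differentiableWithinAt) (fun z hz => hc z hz) hs
        (show (1:ℝ) ∈ Set.Ioi 0 by simp)
    refine ⟨deriv G 1, G 1 - deriv G 1, fun s hs => ?_⟩
    have hH : ∀ z : ℝ, 0 < z → HasDerivAt (fun z => G z - deriv G 1 * z) 0 z := by
      intro z hz
      have := (hG1 z hz).hasDerivAt.sub ((hasDerivAt_id z).const_mul (deriv G 1))
      rw [hconst z hz, mul_one, sub_self] at this
      exact this
    have h2 : G s - deriv G 1 * s = G 1 - deriv G 1 * 1 :=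
      isOpen_Ioi.is_const_of_deriv_eq_zero (f := fun z => G z - deriv G 1 * z)
        (convex_Ioi 0).isPreconnected
        (fun z hz => (hH z hz).differentiableAt.differentiableWithinAt)
        (fun z hz => (hH z hz).deriv) hs (show (1:ℝ) ∈ Set.Ioi 0 by simp)
    linarith
  · left
    push Not at hc
    obtain ⟨s, hs, hs'⟩ := hc
    have hzero : ∀ x ∈ posOrth 2, pd 0 (pd 0 g) x = 0 := by
      intro x hx
      have ht : 0 < s / g x := div_pos hs (hgpos x hx)
      set t := s / g x with htd
      have hgt : g (t • x) = s := by
        rw [hh t ht x hx, htd]; field_simp [(hgpos x hx).ne']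
      have h0 : pd 0 (pd 0 g) (t • x) = 0 := by
        have := key (t • x) (smul_posOrth2 ht hx)
        rw [hgt] at this
        exact (mul_eq_zero.mp this).resolve_left hs'
      have h1 : ∀ y ∈ posOrth 2, pd 0 g (t • y) = 1 * pd 0 g y := by
        intro y hy
        have := pd_scale (hh t ht) hy (diff_of_C2 hg hy) 0
        rw [one_mul]
        exact mul_left_cancel₀ ht.ne' this
      have h2 := pd_scale h1 hx (pd_diff hg hx 0) 0
      rw [h0] at h2
      linarith
    have hall : ∀ x ∈ posOrth 2, ∀ i j, pd i (pd j g) x = 0 := by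
      intro x hx
      have e0 := euler2 hg 0 hh' hx 0
      have e1 := euler2 hg 0 hh' hx 1
      have hs := pd_symm hg hx 1 0
      rw [hzero x hx] at e0
      have hB : pd 0 (pd 1 g) x = 0 := by
        have := hx 1
        have h3 : x 1 * pd 0 (pd 1 g) x = 0 := by linarith
        exact (mul_eq_zero.mp h3).resolve_left this.ne'
      rw [hs, hB] at e1
      have hD : pd 1 (pd 1 g) x = 0 := by
        have := hx 1
        have h3 : x 1 * pd 1 (pd 1 g) x = 0 := by linarith
        exact (mul_eq_zero.mp h3).resolve_left this.ne'
      intro i j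
      fin_cases i <;> fin_cases j
      · exact hzero x hx
      · exact hB
      · exact hs.trans hB
      · exact hD
    have h1 : (fun _ => 1 : Fin 2 → ℝ) ∈ posOrth 2 := fun i => one_pos
    refine ⟨pd 0 g (fun _ => 1), pd 1 g (fun _ => 1), fun x hx => ?_⟩
    have e := euler hg 0 hh' hx
    rw [const_of_pd (k := pd 0 g) (fun z hz => pd_diff hg hz 0) (fun z hz i => hall z hz i 0) hx h1,
      const_of_pd (k := pd 1 g) (fun z hz => pd_diff hg hz 1) (fun z hz i => hall z hz i 1) hx h1] at e
    linarith

/-- For a C² function `h : ℝ²₊ → ℝ₊` homogeneous of degree `d ≠ 0` and a C²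
function `F : ℝ₊ → ℝ` with `F′ ≠ 0` everywhere, `f = F ∘ h` satisfies `det(f_ij) = 0` on
`ℝ²₊` iff either (1) `h(x,y) = (a·x + b·y)^d` for some constants `a, b`, or
(2) `f − β` is homogeneous of degree 1 for some constant `β`. -/
theorem stmt_2 (d : ℝ) (hd0 : d ≠ 0)
    (h : (Fin 2 → ℝ) → ℝ)
    (hC2 : ContDiffOn ℝ 2 h (posOrth 2))
    (hpos : ∀ x ∈ posOrth 2, 0 < h x)
    (hhom : ∀ t : ℝ, 0 < t → ∀ x ∈ posOrth 2, h (t • x) = t ^ d * h x)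
    (F : ℝ → ℝ) (hFC2 : ContDiffOn ℝ 2 F (Set.Ioi (0 : ℝ)))
    (hF' : ∀ u : ℝ, 0 < u → deriv F u ≠ 0) :
    (∀ x ∈ posOrth 2, hessDet (fun y => F (h y)) x = 0) ↔
      ((∃ a b : ℝ, ∀ x ∈ posOrth 2, h x = (a * x 0 + b * x 1) ^ d) ∨
       (∃ β : ℝ, ∀ t : ℝ, 0 < t → ∀ x ∈ posOrth 2,
          F (h (t • x)) - β = t * (F (h x) - β))) := by
  have hf : ContDiffOn ℝ 2 (fun y => F (h y)) (posOrth 2) :=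
    hFC2.comp hC2 (fun x hx => hpos x hx)
  constructor
  · intro hdet
    have hg : ContDiffOn ℝ 2 (fun x => h x ^ d⁻¹) (posOrth 2) :=
      hC2.rpow_const_of_ne (fun x hx => (hpos x hx).ne')
    have hgpos : ∀ x ∈ posOrth 2, 0 < (fun x => h x ^ d⁻¹) x :=
      fun x hx => Real.rpow_pos_of_pos (hpos x hx) _
    have hG : ContDiffOn ℝ 2 (fun s : ℝ => F (s ^ d)) (Set.Ioi 0) :=
      hFC2.comp (contDiffOn_id.rpow_const_of_ne (fun x hx => (Set.mem_Ioi.mp hx).ne'))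
        (fun x hx => Real.rpow_pos_of_pos hx _)
    have hG' : ∀ s : ℝ, 0 < s → deriv (fun s : ℝ => F (s ^ d)) s ≠ 0 := by
      intro s hs
      have hsd : 0 < s ^ d := Real.rpow_pos_of_pos hs _
      have h1 : DifferentiableAt ℝ F (s ^ d) :=
        (hFC2.differentiableOn (by norm_num)).differentiableAt (isOpen_Ioi.mem_nhds hsd)
      have h2 := h1.hasDerivAt.comp s (Real.hasDerivAt_rpow_const (p := d) (Or.inl hs.ne'))
      have h3 : deriv (fun s : ℝ => F (s ^ d)) s = _ := h2.deriv
      rw [h3]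
      exact mul_ne_zero (hF' _ hsd) (mul_ne_zero hd0 (Real.rpow_pos_of_pos hs _).ne')
    have hinv : ∀ x ∈ posOrth 2, (h x ^ d⁻¹) ^ d = h x := fun x hx =>
      Real.rpow_inv_rpow (hpos x hx).le hd0
    have hh : ∀ t : ℝ, 0 < t → ∀ x ∈ posOrth 2,
        (fun x => h x ^ d⁻¹) (t • x) = t * (fun x => h x ^ d⁻¹) x := by
      intro t ht x hx
      simp only
      rw [hhom t ht x hx, Real.mul_rpow (Real.rpow_pos_of_pos ht _).le (hpos x hx).le,
        Real.rpow_rpow_inv ht.le hd0]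
    have hdet' : ∀ x ∈ posOrth 2,
        hessDet (fun y => (fun s : ℝ => F (s ^ d)) ((fun x => h x ^ d⁻¹) y)) x = 0 := by
      intro x hx
      have h0 := hdet x hx
      rw [hessDet_eq] at h0 ⊢
      have hc : ∀ y ∈ posOrth 2,
          (fun y => (fun s : ℝ => F (s ^ d)) ((fun x => h x ^ d⁻¹) y)) y = F (h y) := by
        intro y hy
        simp only [hinv y hy]
      have hc2 : ∀ i j, pd i (pd j (fun y => (fun s : ℝ => F (s ^ d))
          ((fun x => h x ^ d⁻¹) y))) x = pd i (pd j (fun y => F (h y))) x := fun i j =>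
        pd_congr (fun y hy => pd_congr hc hy j) hx i
      simp only [hc2]
      exact h0
    rcases core hg hgpos hG hG' hh hdet' with ⟨a, b, hab⟩ | ⟨α, β, hαβ⟩
    · left
      refine ⟨a, b, fun x hx => ?_⟩
      rw [← hab x hx, hinv x hx]
    · right
      refine ⟨β, fun t ht x hx => ?_⟩
      have hs : ∀ y ∈ posOrth 2, F (h y) = α * h y ^ d⁻¹ + β := by
        intro y hy
        have := hαβ (h y ^ d⁻¹) (hgpos y hy)
        simp only [hinv y hy] at this
        exact this
      have h2 := hh t ht x hx
      simp only at h2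
      rw [hs _ (smul_posOrth2 ht hx), hs x hx, h2]
      ring
  · rintro (⟨a, b, hab⟩ | ⟨β, hβ⟩) x hx
    · refine det_zero_of_lin hf a b ?_ (fun s => F (s ^ d)) (fun y hy => by simp only [hab y hy]) hx
      by_contra! hcon
      obtain ⟨hb, ha⟩ := hcon
      have h1 := hab x hx
      have ha' : a = 0 := by linarith
      rw [ha', hb] at h1
      simp [Real.zero_rpow hd0] at h1
      exact (hpos x hx).ne' h1
    · exact det_zero_of_hom hf β hβ hx
end

section
/- Let h : ℝ²₊ → ℝ be a twice continuously differentiable function that is homogeneous of degree 1 and nowhere vanishing on ℝ²₊. If h satisfies h₁²·h₂₂ + h₂²·h₁₁ − 2·h₁·h₂·h₁₂ = 0 at every point of ℝ²₊, then h₁₂ = 0 at every point of ℝ²₊ (here h₁ = h_x, h₂ = h_y, h₁₁ = h_xx, h₁₂ = h_xy, h₂₂ = h_yy). -/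
open Real

/-- Let `h : ℝ²₊ → ℝ` be C², homogeneous of degree 1, and nowhere
vanishing on `ℝ²₊`. If `h₁²·h₂₂ + h₂²·h₁₁ − 2·h₁·h₂·h₁₂ = 0` at every point of `ℝ²₊`,
then `h₁₂ = 0` at every point of `ℝ²₊`. -/
theorem stmt_14
    (h : (Fin 2 → ℝ) → ℝ)
    (hC2 : ContDiffOn ℝ 2 h (posOrth 2))
    (hhom : ∀ t : ℝ, 0 < t → ∀ x ∈ posOrth 2, h (t • x) = t * h x)
    (hne : ∀ x ∈ posOrth 2, h x ≠ 0)
    (heq : ∀ x ∈ posOrth 2,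
      (pd 0 h x) ^ 2 * pd 1 (pd 1 h) x + (pd 1 h x) ^ 2 * pd 0 (pd 0 h) x
        - 2 * pd 0 h x * pd 1 h x * pd 0 (pd 1 h) x = 0) :
    ∀ x ∈ posOrth 2, pd 0 (pd 1 h) x = 0 := by
  have hopen : IsOpen (posOrth 2) := by
    have : posOrth 2 = ⋂ i : Fin 2, {x : Fin 2 → ℝ | 0 < x i} := by
      ext x; simp [posOrth]
    rw [this]
    exact isOpen_iInter_of_finite fun i => isOpen_lt continuous_const (continuous_apply i)
  have hcd : ∀ x ∈ posOrth 2, ContDiffAt ℝ 2 h x := fun x hx =>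
    hC2.contDiffAt (hopen.mem_nhds hx)
  have euler : ∀ x ∈ posOrth 2, fderiv ℝ h x x = h x := by
    intro x hx
    have hd : HasFDerivAt h (fderiv ℝ h x) ((1 : ℝ) • x) := by
      rw [one_smul]
      exact ((hcd x hx).differentiableAt (by norm_num)).hasFDerivAt
    have h1 : HasDerivAt (fun t : ℝ => t • x) x 1 := by
      simpa using (hasDerivAt_id (1 : ℝ)).smul_const x
    have h2 : HasDerivAt (fun t : ℝ => h (t • x)) (fderiv ℝ h x x) 1 :=
      hd.comp_hasDerivAt 1 h1
    have h3 : HasDerivAt (fun t : ℝ => t * h x) (h x) 1 := by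
      simpa using (hasDerivAt_id (1 : ℝ)).mul_const (h x)
    have h4 : (fun t : ℝ => h (t • x)) =ᶠ[nhds 1] (fun t : ℝ => t * h x) := by
      filter_upwards [lt_mem_nhds (zero_lt_one' ℝ)] with t ht
      exact hhom t ht x hx
    exact h2.unique (h3.congr_of_eventuallyEq h4)
  intro x hx
  have hD : DifferentiableAt ℝ (fderiv ℝ h) x :=
    ((hcd x hx).fderiv_right (m := 1) (by norm_num)).differentiableAt (by norm_num)
  have hpd : ∀ i j : Fin 2, pd i (pd j h) x =
      fderiv ℝ (fderiv ℝ h) x (Pi.single i 1) (Pi.single j 1) := by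
    intro i j
    have := hD.hasFDerivAt.clm_apply (hasFDerivAt_const (Pi.single j (1 : ℝ)) x)
    change fderiv ℝ (fun y => fderiv ℝ h y (Pi.single j 1)) x (Pi.single i 1) = _
    rw [this.fderiv]
    simp
  have hsymm : IsSymmSndFDerivAt ℝ h x :=
    (hcd x hx).isSymmSndFDerivAt (by simp)
  have hz : ∀ v, fderiv ℝ (fderiv ℝ h) x v x = 0 := by
    intro v
    have h1 := hD.hasFDerivAt.clm_apply (hasFDerivAt_id x)
    have h2 : HasFDerivAt h (fderiv ℝ h x) x :=
      ((hcd x hx).differentiableAt (by norm_num)).hasFDerivAt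
    have h4 : (fun y => fderiv ℝ h y (id y)) =ᶠ[nhds x] h := by
      filter_upwards [hopen.mem_nhds hx] with y hy
      exact euler y hy
    have h5 := h1.unique (h2.congr_of_eventuallyEq h4)
    have h6 := congrArg (fun L => L v) h5
    simpa using h6
  have hxe : x = x 0 • Pi.single (0 : Fin 2) (1 : ℝ) + x 1 • Pi.single (1 : Fin 2) (1 : ℝ) := by
    ext i; fin_cases i <;> simp
  have hlin : ∀ L : (Fin 2 → ℝ) →L[ℝ] ℝ,
      L x = x 0 * L (Pi.single 0 1) + x 1 * L (Pi.single 1 1) := by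
    intro L
    conv_lhs => rw [hxe]
    simp only [map_add, map_smul, smul_eq_mul]
  have e := euler x hx
  have z0 := hz (Pi.single 0 1)
  have z1 := hz (Pi.single 1 1)
  rw [hlin] at e z0 z1
  have hs := hsymm (Pi.single 0 1) (Pi.single 1 1)
  rw [← hpd, ← hpd] at z0 z1 hs
  rw [← hs] at z1
  have hh := heq x hx
  change x 0 * pd 0 h x + x 1 * pd 1 h x = h x at e
  have hn := hne x hx
  rw [← e] at hn
  have key : pd 0 (pd 1 h) x * (x 0 * pd 0 h x + x 1 * pd 1 h x) ^ 2 = 0 := by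
    linear_combination (-(x 0 * x 1)) * hh + (x 1 * pd 1 h x ^ 2) * z0
      + (x 0 * pd 0 h x ^ 2) * z1
  exact (mul_eq_zero.mp key).resolve_right (pow_ne_zero 2 hn)
end
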